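/- Let ℓ > 0 and α = 1/√2, and set τ = √((1/2)/(1/2+δ²+ε²)) and λ = ε²/(1/2+δ²+ε²), so that λ_n = τ·λ^n. Let M ≥ 1 and let x_1, …, x_N ∈ ℝ and w_1, …, w_N ∈ ℝ satisfy: (i) ∑_{m=1}^N |w_m| ≤ W for some W ≥ 0; (ii) ∑_{m=1}^N w_m·φ_n(x_m) = ∫_ℝ φ_n dμ for every n = 0, …, M−1; (iii) |x_m| ≤ 2·√M/β for all m. Then ∑_{n=M}^{∞} λ_n^{1/2} · |∫_ℝ φ_n dμ − ∑_{m=1}^N w_m·φ_n(x_m)| ≤ (1 + K·√β·W) · (√τ/(1−√λ)) · (√λ·e^{1/β²})^M, where K = 1.087, and √λ·e^{1/β²} < 1. -/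

import Mathlib

open MeasureTheory ProbabilityTheory

/-- Probabilists' Hermite polynomial evaluated at a real number. -/
noncomputable def H (n : ℕ) (x : ℝ) : ℝ := Polynomial.aeval x (Polynomial.hermite n)

/-- The standard Gaussian measure on ℝ. -/
noncomputable def stdGauss : Measure ℝ := gaussianReal 0 1

theorem hasDerivAt_cos_mul_sin_rpow (s : ℝ) {θ : ℝ} (h0 : 0 < Real.sin θ) :
    HasDerivAt (fun θ => Real.cos θ * Real.sin θ ^ (s + 1))
      ((s + 1) * Real.sin θ ^ s - (s + 2) * Real.sin θ ^ (s + 2)) θ := by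
  refine ((Real.hasDerivAt_cos θ).mul
    ((Real.hasDerivAt_sin θ).rpow_const (p := s + 1) (Or.inl h0.ne'))).congr_deriv ?_
  rw [show s + 2 = s + 1 + 1 by ring, Real.rpow_add_one h0.ne' (s + 1),
    Real.rpow_add_one h0.ne' s, add_sub_cancel_right]
  linear_combination ((s + 1) * Real.sin θ ^ s) * Real.sin_sq_add_cos_sq θ

theorem intervalIntegrable_sin_rpow {s : ℝ} (hs : -1 < s) :
    IntervalIntegrable (fun θ => Real.sin θ ^ s) volume 0 Real.pi := by
  have hcont : Continuous fun θ => Real.sin θ ^ (s + 2) :=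
    Real.continuous_sin.rpow_const fun _ => Or.inr (by linarith)
  have hint : IntervalIntegrable
      (fun θ => ((s + 1) * Real.sin θ ^ s - (s + 2) * Real.sin θ ^ (s + 2)) + (s + 2))
      volume 0 Real.pi := by
    have hg : Continuous fun θ => Real.cos θ * Real.sin θ ^ (s + 1) + (s + 2) * θ :=
      (Real.continuous_cos.mul (Real.continuous_sin.rpow_const fun _ => Or.inr (by linarith))).add
        (continuous_const.mul continuous_id)
    refine intervalIntegral.intervalIntegrable_deriv_of_nonneg hg.continuousOn ?_ ?_
    · intro θ hθ
      rw [min_eq_left Real.pi_pos.le, max_eq_right Real.pi_pos.le] at hθ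
      refine ((hasDerivAt_cos_mul_sin_rpow s (Real.sin_pos_of_mem_Ioo hθ)).add
        ((hasDerivAt_id θ).const_mul (s + 2))).congr_deriv ?_
      rw [mul_one]
    · intro θ hθ
      rw [min_eq_left Real.pi_pos.le, max_eq_right Real.pi_pos.le] at hθ
      have h0 := Real.sin_pos_of_mem_Ioo hθ
      have h1 := Real.rpow_le_one h0.le (Real.sin_le_one θ) (z := s + 2) (by linarith)
      have h2 := mul_nonneg (by linarith : 0 ≤ s + 1) (Real.rpow_nonneg h0.le s)
      nlinarith
  have h := ((hint.sub (intervalIntegrable_const (c := s + 2))).add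
    ((hcont.intervalIntegrable 0 Real.pi).const_mul (s + 2))).const_mul (s + 1)⁻¹
  refine h.congr fun θ _ => ?_
  have : s + 1 ≠ 0 := by linarith
  simp
  field_simp

theorem integral_sin_rpow {s : ℝ} (hs : -1 < s) :
    ∫ θ in (0 : ℝ)..Real.pi, Real.sin θ ^ s =
      (s + 2) / (s + 1) * ∫ θ in (0 : ℝ)..Real.pi, Real.sin θ ^ (s + 2) := by
  have i1 := (intervalIntegrable_sin_rpow hs).const_mul (s + 1)
  have i2 := (intervalIntegrable_sin_rpow (s := s + 2) (by linarith)).const_mul (s + 2)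
  have hg : Continuous fun θ => Real.cos θ * Real.sin θ ^ (s + 1) :=
    Real.continuous_cos.mul (Real.continuous_sin.rpow_const fun _ => Or.inr (by linarith))
  have h := intervalIntegral.integral_eq_sub_of_hasDerivAt_of_le Real.pi_pos.le hg.continuousOn
    (f' := fun θ => (s + 1) * Real.sin θ ^ s - (s + 2) * Real.sin θ ^ (s + 2))
    (fun θ hθ => hasDerivAt_cos_mul_sin_rpow s (Real.sin_pos_of_mem_Ioo hθ))
    (i1.sub i2)
  rw [intervalIntegral.integral_sub i1 i2, intervalIntegral.integral_const_mul,
    intervalIntegral.integral_const_mul] at h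
  have hs1 : s + 1 ≠ 0 := by linarith
  simp [Real.zero_rpow hs1] at h
  field_simp
  linarith

theorem integral_sin_rpow_neg_half_le :
    ∫ θ in (0 : ℝ)..Real.pi, Real.sin θ ^ (-1 / 2 : ℝ) ≤ 5.249 := by
  have h9 : ∫ θ in (0 : ℝ)..Real.pi, Real.sin θ ^ 9 = 256 / 315 := by
    rw [show 9 = 2 * 4 + 1 by rfl, integral_sin_pow_odd]
    norm_num [Finset.prod_range_succ]
  have h10 : ∫ θ in (0 : ℝ)..Real.pi, Real.sin θ ^ 10 = Real.pi * (63 / 256) := by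
    rw [show 10 = 2 * 5 by rfl, integral_sin_pow_even]
    norm_num [Finset.prod_range_succ]
  have i9 : IntervalIntegrable (fun θ => 0.975 / 2 * Real.sin θ ^ 9) volume 0 Real.pi :=
    Continuous.intervalIntegrable (by fun_prop) _ _
  have i10 : IntervalIntegrable (fun θ => 1 / 1.95 * Real.sin θ ^ 10) volume 0 Real.pi :=
    Continuous.intervalIntegrable (by fun_prop) _ _
  have hle : ∫ θ in (0 : ℝ)..Real.pi, Real.sin θ ^ (19 / 2 : ℝ) ≤
      0.975 / 2 * (256 / 315) + 1 / 1.95 * (Real.pi * (63 / 256)) := by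
    rw [← h9, ← h10, ← intervalIntegral.integral_const_mul, ← intervalIntegral.integral_const_mul,
      ← intervalIntegral.integral_add i9 i10]
    refine intervalIntegral.integral_mono_on Real.pi_pos.le
      (intervalIntegrable_sin_rpow (by norm_num)) (i9.add i10) fun θ hθ => ?_
    have h0 := Real.sin_nonneg_of_mem_Icc hθ
    have e1 : Real.sin θ ^ (19 / 2 : ℝ) = Real.sin θ ^ 9 * √(Real.sin θ) := by
      rw [Real.sqrt_eq_rpow, ← Real.rpow_natCast, ← Real.rpow_add_of_nonneg h0 (by norm_num)
        (by norm_num)]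
      norm_num
    have e2 : Real.sin θ ^ 10 = Real.sin θ ^ 9 * √(Real.sin θ) ^ 2 := by
      rw [Real.sq_sqrt h0]; ring
    rw [e1, e2]
    have := mul_nonneg (pow_nonneg h0 9) (sq_nonneg (√(Real.sin θ) - 0.975))
    norm_num at this ⊢
    linarith
  rw [integral_sin_rpow (by norm_num), show (-1 / 2 + 2 : ℝ) = 3 / 2 by norm_num,
    integral_sin_rpow (by norm_num), show (3 / 2 + 2 : ℝ) = 7 / 2 by norm_num,
    integral_sin_rpow (by norm_num), show (7 / 2 + 2 : ℝ) = 11 / 2 by norm_num,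
    integral_sin_rpow (by norm_num), show (11 / 2 + 2 : ℝ) = 15 / 2 by norm_num,
    integral_sin_rpow (by norm_num), show (15 / 2 + 2 : ℝ) = 19 / 2 by norm_num]
  norm_num at hle ⊢
  linarith [Real.pi_lt_d4]

theorem integral_abs_sin_rpow_two_pi {s : ℝ} (hs : -1 < s) :
    IntervalIntegrable (fun θ => |Real.sin θ| ^ s) volume 0 (2 * Real.pi) ∧
    ∫ θ in (0 : ℝ)..(2 * Real.pi), |Real.sin θ| ^ s =
      2 * ∫ θ in (0 : ℝ)..Real.pi, Real.sin θ ^ s := by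
  have e : ∀ θ ∈ Set.uIcc 0 Real.pi, Real.sin θ ^ s = |Real.sin θ| ^ s := fun θ hθ => by
    rw [Set.uIcc_of_le Real.pi_pos.le] at hθ
    rw [abs_of_nonneg (Real.sin_nonneg_of_mem_Icc hθ)]
  have i1 : IntervalIntegrable (fun θ => |Real.sin θ| ^ s) volume 0 Real.pi :=
    (intervalIntegrable_sin_rpow hs).congr fun θ hθ => e θ (Set.uIoc_subset_uIcc hθ)
  have i2 : IntervalIntegrable (fun θ => |Real.sin θ| ^ s) volume Real.pi (2 * Real.pi) := by
    have := i1.comp_sub_right Real.pi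
    simpa [Real.sin_sub_pi, two_mul] using this
  refine ⟨i1.trans i2, ?_⟩
  have h2 : ∫ θ in Real.pi..(2 * Real.pi), |Real.sin θ| ^ s =
      ∫ θ in (0 : ℝ)..Real.pi, |Real.sin θ| ^ s := by
    have := intervalIntegral.integral_comp_sub_right (a := Real.pi) (b := 2 * Real.pi)
      (fun θ => |Real.sin θ| ^ s) Real.pi
    simpa [Real.sin_sub_pi, two_mul] using this
  rw [← intervalIntegral.integral_add_adjacent_intervals i1 i2, h2,
    intervalIntegral.integral_congr e, two_mul]

theorem derivative_hermite_succ (n : ℕ) :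
    Polynomial.derivative (Polynomial.hermite (n + 1)) =
      ((n : Polynomial ℤ) + 1) * Polynomial.hermite n := by
  induction n with
  | zero => simp
  | succ n ih =>
    rw [Polynomial.hermite_succ (n + 1), Polynomial.derivative_sub, Polynomial.derivative_mul,
      Polynomial.derivative_X, ih, Polynomial.derivative_mul, Polynomial.hermite_succ n]
    simp
    ring

theorem H_zero (y : ℝ) : H 0 y = 1 := by simp [H]

theorem H_one (y : ℝ) : H 1 y = y := by simp [H]

theorem H_add_two (n : ℕ) (y : ℝ) : H (n + 2) y = y * H (n + 1) y - (n + 1) * H n y := by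
  simp only [H]
  rw [Polynomial.hermite_succ (n + 1), derivative_hermite_succ]
  simp

/-- Mehler's generating function `∑ H_n(y)² zⁿ / n!` on the diagonal. -/
noncomputable def mehlerDiag (y : ℝ) (z : ℂ) : ℂ :=
  (1 - z ^ 2) ^ ((-1 / 2 : ℝ) : ℂ) * Complex.exp (y ^ 2 * (z / (1 + z)))

theorem one_add_ne_zero_of_norm_lt_one {z : ℂ} (hz : ‖z‖ < 1) : 1 + z ≠ 0 := fun h => by
  rw [eq_neg_of_add_eq_zero_right h] at hz
  simp at hz

theorem one_sub_sq_mem_slitPlane {z : ℂ} (hz : ‖z‖ < 1) : 1 - z ^ 2 ∈ Complex.slitPlane := by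
  left
  have h1 : (z ^ 2).re ≤ ‖z ^ 2‖ := Complex.re_le_norm _
  rw [norm_pow] at h1
  have h2 : ‖z‖ ^ 2 < 1 := by nlinarith [norm_nonneg z]
  rw [Complex.sub_re, Complex.one_re]
  linarith

theorem hasDerivAt_mehlerDiag (y : ℝ) {z : ℂ} (hz : ‖z‖ < 1) :
    HasDerivAt (mehlerDiag y)
      ((z / (1 - z ^ 2) + y ^ 2 / (1 + z) ^ 2) * mehlerDiag y z) z := by
  have h1 := one_add_ne_zero_of_norm_lt_one hz
  have h2 := one_sub_sq_mem_slitPlane hz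
  have h3 := Complex.slitPlane_ne_zero h2
  refine ((((hasDerivAt_pow 2 z).const_sub 1).cpow_const (c := ((-1 / 2 : ℝ) : ℂ)) h2).mul
    ((((hasDerivAt_id z).div ((hasDerivAt_id z).const_add 1) h1).const_mul
      ((y : ℂ) ^ 2)).cexp)).congr_deriv ?_
  rw [mehlerDiag, Complex.cpow_sub _ _ h3, Complex.cpow_one]
  simp only [id, Pi.div_apply]
  push_cast
  field_simp
  ring

theorem norm_mehlerDiag_le (y : ℝ) {z : ℂ} (hz : ‖z‖ < 1) (him : z.im ≠ 0) :
    ‖mehlerDiag y z‖ ≤ (2 * |z.im|) ^ (-1 / 2 : ℝ) * Real.exp (y ^ 2 / 2) := by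
  have hn : ‖z‖ ^ 2 < 1 := by nlinarith [norm_nonneg z]
  rw [← Complex.normSq_eq_norm_sq, Complex.normSq_apply] at hn
  rw [mehlerDiag, norm_mul, Complex.norm_cpow_real, Complex.norm_exp]
  refine mul_le_mul (Real.rpow_le_rpow_of_nonpos (by positivity) ?_ (by norm_num))
    (Real.exp_le_exp.2 ?_) (Real.exp_pos _).le (by positivity)
  · refine abs_le_of_sq_le_sq' ?_ (norm_nonneg _) |>.2
    rw [← Complex.normSq_eq_norm_sq, Complex.normSq_apply, mul_pow, sq_abs]
    simp [pow_two]
    nlinarith [sq_nonneg (1 - z.re * z.re - z.im * z.im)]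
  · rw [← Complex.ofReal_pow, Complex.re_ofReal_mul, div_eq_mul_one_div (y ^ 2)]
    refine mul_le_mul_of_nonneg_left ?_ (sq_nonneg y)
    have h0 : 0 < Complex.normSq (1 + z) :=
      Complex.normSq_pos.2 (one_add_ne_zero_of_norm_lt_one hz)
    rw [Complex.div_re, ← add_div, div_le_div_iff₀ h0 two_pos, Complex.normSq_apply]
    simp
    nlinarith

theorem mehlerDiag_coeff_recurrence (y : ℝ) {r : ℝ} (hr0 : 0 < r) (hr1 : r < 1) (k : ℤ) :
    k * (∮ z in C(0, r), mehlerDiag y z * z ^ (k - 1)) +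
      (k + 1 + y ^ 2) * (∮ z in C(0, r), mehlerDiag y z * z ^ k) -
      (k + 1 + y ^ 2) * (∮ z in C(0, r), mehlerDiag y z * z ^ (k + 1)) -
      (k + 2) * (∮ z in C(0, r), mehlerDiag y z * z ^ (k + 2)) = 0 := by
  have hz0 : ∀ z ∈ Metric.sphere (0 : ℂ) r, z ≠ 0 ∧ ‖z‖ < 1 := fun z hz => by
    rw [mem_sphere_zero_iff_norm] at hz
    exact ⟨norm_pos_iff.1 (hz ▸ hr0), hz ▸ hr1⟩
  have hc : ∀ j : ℤ, CircleIntegrable (fun z => mehlerDiag y z * z ^ j) 0 r := fun j =>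
    ContinuousOn.circleIntegrable hr0.le fun z hz =>
      ((hasDerivAt_mehlerDiag y (hz0 z hz).2).continuousAt.mul
        (continuousAt_zpow₀ z j (Or.inl (hz0 z hz).1))).continuousWithinAt
  have h := circleIntegral.integral_eq_zero_of_hasDerivWithinAt hr0.le
    (f := fun z => (1 + z - z ^ 2 - z ^ 3) * mehlerDiag y z * z ^ k)
    (f' := fun z => k * (mehlerDiag y z * z ^ (k - 1)) +
      (k + 1 + y ^ 2) * (mehlerDiag y z * z ^ k) -
      (k + 1 + y ^ 2) * (mehlerDiag y z * z ^ (k + 1)) -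
      (k + 2) * (mehlerDiag y z * z ^ (k + 2))) (c := 0) (fun z hz => by
    obtain ⟨h0, h1⟩ := hz0 z hz
    have h2 := one_add_ne_zero_of_norm_lt_one h1
    have h3 := Complex.slitPlane_ne_zero (one_sub_sq_mem_slitPlane h1)
    refine (((((((hasDerivAt_id z).const_add 1).sub (hasDerivAt_pow 2 z)).sub
      (hasDerivAt_pow 3 z)).mul (hasDerivAt_mehlerDiag y h1)).mul
      (hasDerivAt_zpow k z (Or.inl h0))).congr_deriv ?_).hasDerivWithinAt
    have e1 : z ^ k = z ^ (k - 1) * z := by rw [← zpow_add_one₀ h0, sub_add_cancel]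
    have e2 : z ^ (k + 1) = z ^ (k - 1) * z ^ 2 := by rw [zpow_add_one₀ h0, e1]; ring
    have e3 : z ^ (k + 2) = z ^ (k - 1) * z ^ 3 := by
      rw [show k + 2 = k + 1 + 1 by ring, zpow_add_one₀ h0, e2]; ring
    have e4 : (1 + z - z ^ 2 - z ^ 3) * (z / (1 - z ^ 2) + y ^ 2 / (1 + z) ^ 2) =
        z + z ^ 2 + y ^ 2 * (1 - z) := by
      field_simp
      ring
    simp only [Pi.mul_apply, Pi.sub_apply, id, e1, e2, e3]
    push_cast
    linear_combination (mehlerDiag y z * z ^ (k - 1) * z) * e4)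
  have i : ∀ (a : ℂ) (j : ℤ), CircleIntegrable (fun z => a * (mehlerDiag y z * z ^ j)) 0 r :=
    fun a j => (hc j).const_mul a
  have i1 : CircleIntegrable (fun z => k * (mehlerDiag y z * z ^ (k - 1)) +
      (k + 1 + y ^ 2) * (mehlerDiag y z * z ^ k)) 0 r := (i _ _).add (i _ _)
  have i2 : CircleIntegrable (fun z => k * (mehlerDiag y z * z ^ (k - 1)) +
      (k + 1 + y ^ 2) * (mehlerDiag y z * z ^ k) -
      (k + 1 + y ^ 2) * (mehlerDiag y z * z ^ (k + 1))) 0 r := i1.sub (i _ _)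
  rwa [circleIntegral.integral_sub i2 (i _ _), circleIntegral.integral_sub i1 (i _ _),
    circleIntegral.integral_add (i _ _) (i _ _), circleIntegral.integral_const_mul,
    circleIntegral.integral_const_mul, circleIntegral.integral_const_mul,
    circleIntegral.integral_const_mul] at h

theorem H_sq_div_factorial_recurrence (n : ℕ) (y : ℝ) :
    (n + 3) * (H (n + 3) y ^ 2 / (n + 3).factorial) =
      (y ^ 2 - (n + 2)) * (H (n + 2) y ^ 2 / (n + 2).factorial) -
      (y ^ 2 - (n + 2)) * (H (n + 1) y ^ 2 / (n + 1).factorial) +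
      (n + 1) * (H n y ^ 2 / n.factorial) := by
  have hf : (n.factorial : ℝ) ≠ 0 := by positivity
  rw [H_add_two (n + 1), H_add_two n]
  simp only [Nat.factorial_succ]
  push_cast
  field_simp
  ring

theorem circleIntegral_mehlerDiag (y : ℝ) {r : ℝ} (hr0 : 0 < r) (hr1 : r < 1) (n : ℕ) :
    ∮ z in C(0, r), mehlerDiag y z * z ^ (-(n : ℤ) - 1) =
      2 * Real.pi * Complex.I * (((H n y) ^ 2 / n.factorial : ℝ) : ℂ) := by
  have hd : DiffContOnCl ℂ (mehlerDiag y) (Metric.ball 0 r) := by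
    refine DifferentiableOn.diffContOnCl_ball (U := Metric.ball 0 1) (fun z hz => ?_)
      (Metric.closedBall_subset_ball hr1)
    exact (hasDerivAt_mehlerDiag y (mem_ball_zero_iff.1 hz)).differentiableAt.differentiableWithinAt
  have hpos : ∀ k : ℕ, ∮ z in C(0, r), mehlerDiag y z * z ^ (k : ℤ) = 0 := fun k => by
    refine DiffContOnCl.circleIntegral_eq_zero hr0.le ?_
    simp only [zpow_natCast]
    exact hd.smul (f := fun z => z ^ k) (differentiable_pow k).diffContOnCl
  have hneg : ∮ z in C(0, r), mehlerDiag y z * z ^ (-1 : ℤ) = 2 * Real.pi * Complex.I := by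
    have := hd.circleIntegral_sub_inv_smul (Metric.mem_ball_self hr0)
    simpa [mehlerDiag, mul_comm] using this
  have hrec := mehlerDiag_coeff_recurrence y hr0 hr1
  suffices h : ∀ n : ℕ, ∀ i < 3, ∮ z in C(0, r), mehlerDiag y z * z ^ (-((n + i : ℕ) : ℤ) - 1) =
      2 * Real.pi * Complex.I * (((H (n + i) y) ^ 2 / (n + i).factorial : ℝ) : ℂ) from
    h n 0 three_pos
  have h0 := hpos 0
  have h1 := hpos 1
  have e1 := hrec (-1)
  have e2 := hrec (-2)
  norm_num at h0 h1 e1 e2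
  have k2 : ∮ z in C(0, r), mehlerDiag y z * (z ^ 2)⁻¹ = 2 * Real.pi * Complex.I * y ^ 2 := by
    simp only [zpow_neg_one] at hneg e1
    linear_combination -e1 + y ^ 2 * hneg - (y ^ 2) * h0 - h1
  intro n
  induction n with
  | zero =>
    intro i hi
    interval_cases i
    · simpa [H_zero] using hneg
    · norm_num [H_one, ← k2]
    · norm_num [H_add_two 0, H_zero, H_one]
      simp only [zpow_neg_one] at hneg e2
      linear_combination (-1 / 2) * e2 + (y ^ 2 - 1) / 2 * k2 - (y ^ 2 - 1) / 2 * hneg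
  | succ n ih =>
    intro i hi
    by_cases h : i = 2
    · subst h
      have g0 := ih 0 (by norm_num)
      have g1 := ih 1 (by norm_num)
      have g2 := ih 2 (by norm_num)
      have e := hrec (-n - 3)
      have hr := congrArg (fun t : ℝ => (t : ℂ)) (H_sq_div_factorial_recurrence n y)
      have hn : (n : ℂ) + 3 ≠ 0 := by exact_mod_cast (by omega : n + 3 ≠ 0)
      rw [show n + 1 + 2 = n + 3 by rfl]
      rw [show (-(n : ℤ) - 3 - 1) = -((n + 3 : ℕ) : ℤ) - 1 by push_cast; ring,
        show (-(n : ℤ) - 3) = -((n + 2 : ℕ) : ℤ) - 1 by push_cast; ring,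
        show (-((n + 2 : ℕ) : ℤ) - 1 + 1) = -((n + 1 : ℕ) : ℤ) - 1 by push_cast; ring,
        show (-((n + 2 : ℕ) : ℤ) - 1 + 2) = -((n + 0 : ℕ) : ℤ) - 1 by push_cast; ring,
        g0, g1, g2] at e
      refine mul_left_cancel₀ hn ?_
      simp only [Complex.ofReal_add, Complex.ofReal_mul, Complex.ofReal_sub, Complex.ofReal_pow,
        Complex.ofReal_natCast, Complex.ofReal_ofNat, Complex.ofReal_one, add_zero] at hr e ⊢
      push_cast at hr e ⊢
      linear_combination -e - 2 * Real.pi * Complex.I * hr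
    · have := ih (i + 1) (by omega)
      rwa [show n + (i + 1) = n + 1 + i by ring] at this

theorem H_sq_div_factorial_le (n : ℕ) (y : ℝ) :
    H n y ^ 2 / n.factorial ≤ 1.087 ^ 2 * Real.exp (y ^ 2 / 2) := by
  set I := ∫ θ in (0 : ℝ)..(2 * Real.pi), |Real.sin θ| ^ (-1 / 2 : ℝ) with hI
  obtain ⟨hint, hval⟩ := integral_abs_sin_rpow_two_pi (s := -1 / 2) (by norm_num)
  have key : ∀ r ∈ Set.Ioo (0 : ℝ) 1, 2 * Real.pi * (H n y ^ 2 / n.factorial) ≤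
      r * r ^ (-(n : ℤ) - 1) * Real.exp (y ^ 2 / 2) * (2 * r) ^ (-1 / 2 : ℝ) * I := by
    rintro r ⟨hr0, hr1⟩
    have h := congrArg norm (circleIntegral_mehlerDiag y hr0 hr1 n)
    rw [norm_mul, Complex.norm_real, Real.norm_of_nonneg (by positivity)] at h
    have e : ‖(2 * Real.pi * Complex.I : ℂ)‖ = 2 * Real.pi := by
      simp [abs_of_pos Real.pi_pos]
    rw [e] at h
    rw [← h, circleIntegral, hI, ← intervalIntegral.integral_const_mul]
    refine intervalIntegral.norm_integral_le_of_norm_le (by positivity) ?_ (hint.const_mul _)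
    have hae : ∀ᵐ θ : ℝ, θ ∉ ({Real.pi, 2 * Real.pi} : Set ℝ) :=
      measure_eq_zero_iff_ae_notMem.1
        ((Set.toFinite ({Real.pi, 2 * Real.pi} : Set ℝ)).measure_zero volume)
    filter_upwards [hae] with θ hθ hmem
    have hsin : Real.sin θ ≠ 0 := by
      simp only [Set.mem_insert_iff, Set.mem_singleton_iff, not_or] at hθ
      rcases lt_or_gt_of_ne hθ.1 with hlt | hlt
      · exact (Real.sin_pos_of_pos_of_lt_pi hmem.1 hlt).ne'
      · have := Real.sin_pos_of_pos_of_lt_pi (sub_pos.2 hlt)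
          (by linarith [lt_of_le_of_ne hmem.2 hθ.2])
        rw [Real.sin_sub_pi] at this
        linarith
    have hn : ‖circleMap 0 r θ‖ = r := by simp [abs_of_pos hr0]
    have him : (circleMap 0 r θ).im = r * Real.sin θ := by simp [circleMap, Complex.exp_im]
    have hb := norm_mehlerDiag_le y (hn.trans_lt hr1) (him ▸ mul_ne_zero hr0.ne' hsin)
    rw [him, abs_mul, abs_of_pos hr0, ← mul_assoc, Real.mul_rpow (by positivity) (abs_nonneg _)]
      at hb
    rw [deriv_circleMap, norm_smul, norm_mul, norm_mul, norm_zpow, hn, Complex.norm_I, mul_one]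
    calc _ ≤ r * (((2 * r) ^ (-1 / 2 : ℝ) * |Real.sin θ| ^ (-1 / 2 : ℝ) *
          Real.exp (y ^ 2 / 2)) * r ^ (-(n : ℤ) - 1)) := by gcongr
      _ = _ := by ring
  have hlim : Filter.Tendsto (fun r : ℝ =>
      r * r ^ (-(n : ℤ) - 1) * Real.exp (y ^ 2 / 2) * (2 * r) ^ (-1 / 2 : ℝ) * I)
      (nhdsWithin 1 (Set.Iio 1))
      (nhds (1 * 1 ^ (-(n : ℤ) - 1) * Real.exp (y ^ 2 / 2) * (2 * 1) ^ (-1 / 2 : ℝ) * I)) := by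
    have hc : ContinuousAt (fun r : ℝ =>
        r * r ^ (-(n : ℤ) - 1) * Real.exp (y ^ 2 / 2) * (2 * r) ^ (-1 / 2 : ℝ) * I) 1 :=
      (((continuousAt_id.mul (continuousAt_zpow₀ 1 _ (Or.inl one_ne_zero))).mul
        continuousAt_const).mul ((continuousAt_const.mul continuousAt_id).rpow_const
          (Or.inl (by norm_num)))).mul continuousAt_const
    exact hc.tendsto.mono_left nhdsWithin_le_nhds
  have h := ge_of_tendsto hlim (Filter.mem_of_superset (Ioo_mem_nhdsLT zero_lt_one) key)
  have hI2 : I ≤ 2 * 5.249 := hval.trans_le (by linarith [integral_sin_rpow_neg_half_le])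
  rw [one_zpow, mul_one, mul_one, one_mul, show (-1 / 2 : ℝ) = -(1 / 2) by norm_num,
    Real.rpow_neg two_pos.le, ← Real.sqrt_eq_rpow] at h
  have hs : (1.41421 : ℝ) < √2 := Real.lt_sqrt_of_sq_lt (by norm_num)
  have hc : (√2)⁻¹ * I ≤ 2 * Real.pi * 1.087 ^ 2 := by
    rw [inv_mul_le_iff₀ (by positivity)]
    have := mul_lt_mul'' Real.pi_gt_d6 hs (by norm_num) (by norm_num)
    norm_num at this hI2 ⊢
    linarith
  have := mul_le_mul_of_nonneg_left hc (Real.exp_pos (y ^ 2 / 2)).le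
  refine le_of_mul_le_mul_left ?_ Real.two_pi_pos
  linarith

/-- Cramér's inequality. -/
theorem abs_H_le (n : ℕ) (y : ℝ) :
    |H n y| ≤ 1.087 * √(n.factorial : ℝ) * Real.exp (y ^ 2 / 4) := by
  refine abs_le_of_sq_le_sq ?_ (by positivity)
  have h := H_sq_div_factorial_le n y
  rw [div_le_iff₀ (by positivity)] at h
  rw [mul_pow, mul_pow, Real.sq_sqrt (by positivity), ← Real.exp_nat_mul]
  convert h using 1
  rw [show ((2 : ℕ) : ℝ) * (y ^ 2 / 4) = y ^ 2 / 2 by push_cast; ring]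
  ring

theorem hasDerivAt_H_succ (n : ℕ) (y : ℝ) : HasDerivAt (H (n + 1)) ((n + 1) * H n y) y := by
  have h := (Polynomial.hermite (n + 1)).hasDerivAt_aeval y
  rw [derivative_hermite_succ] at h
  simp only [map_mul, map_add, map_natCast, map_one] at h
  exact h

theorem integrable_pow_mul_H_mul_exp {b : ℝ} (hb : 0 < b) (β : ℝ) (n j : ℕ) :
    Integrable fun x : ℝ => x ^ j * H n (β * x) * Real.exp (-b * x ^ 2) := by
  have base : ∀ j : ℕ, Integrable fun x : ℝ => x ^ j * Real.exp (-b * x ^ 2) := fun j => by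
    simpa only [Real.rpow_natCast] using
      integrable_rpow_mul_exp_neg_mul_sq hb (s := j) (by linarith [j.cast_nonneg (α := ℝ)])
  induction n using Nat.twoStepInduction generalizing j with
  | zero => simpa [H_zero] using base j
  | one =>
    refine ((base (j + 1)).const_mul β).congr (.of_forall fun x => ?_)
    simp only [H_one]
    ring
  | more n h0 h1 =>
    refine (((h1 (j + 1)).const_mul β).sub ((h0 j).const_mul (n + 1))).congr
      (.of_forall fun x => ?_)
    simp only [H_add_two, Pi.sub_apply]
    ring

theorem hasDerivAt_exp_neg_mul_sq (b x : ℝ) :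
    HasDerivAt (fun x : ℝ => Real.exp (-b * x ^ 2)) (-2 * b * x * Real.exp (-b * x ^ 2)) x := by
  refine ((hasDerivAt_pow 2 x).const_mul (-b)).exp.congr_deriv ?_
  push_cast
  ring

theorem integral_H_one_mul_exp {b : ℝ} (hb : 0 < b) (β : ℝ) :
    ∫ x : ℝ, H 1 (β * x) * Real.exp (-b * x ^ 2) = 0 := by
  have i0 : Integrable fun x : ℝ => Real.exp (-b * x ^ 2) := integrable_exp_neg_mul_sq hb
  have i1 : Integrable fun x : ℝ => -2 * b * x * Real.exp (-b * x ^ 2) :=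
    ((integrable_pow_mul_H_mul_exp hb β 0 1).const_mul (-2 * b)).congr
      (.of_forall fun x => by simp only [H_zero]; ring)
  have h := integral_eq_zero_of_hasDerivAt_of_integrable (hasDerivAt_exp_neg_mul_sq b) i1 i0
  have e : ∀ x : ℝ, H 1 (β * x) * Real.exp (-b * x ^ 2) =
      -(β / (2 * b)) * (-2 * b * x * Real.exp (-b * x ^ 2)) := fun x => by
    rw [H_one]
    field_simp
  simp_rw [e]
  rw [integral_const_mul, h, mul_zero]

theorem integral_H_add_two_mul_exp {b : ℝ} (hb : 0 < b) (β : ℝ) (n : ℕ) :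
    ∫ x : ℝ, H (n + 2) (β * x) * Real.exp (-b * x ^ 2) =
      (n + 1) * (β ^ 2 / (2 * b) - 1) * ∫ x : ℝ, H n (β * x) * Real.exp (-b * x ^ 2) := by
  have i0 : ∀ n, Integrable fun x : ℝ => H n (β * x) * Real.exp (-b * x ^ 2) := fun n => by
    simpa using integrable_pow_mul_H_mul_exp hb β n 0
  have i1 : Integrable fun x : ℝ => x * H (n + 1) (β * x) * Real.exp (-b * x ^ 2) := by
    simpa using integrable_pow_mul_H_mul_exp hb β (n + 1) 1
  have hd : ∀ x, HasDerivAt (fun x : ℝ => H (n + 1) (β * x) * Real.exp (-b * x ^ 2))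
      (β * (n + 1) * (H n (β * x) * Real.exp (-b * x ^ 2)) -
        2 * b * (x * H (n + 1) (β * x) * Real.exp (-b * x ^ 2))) x := fun x => by
    have h1 : HasDerivAt (fun x => H (n + 1) (β * x)) ((n + 1) * H n (β * x) * β) x :=
      (hasDerivAt_H_succ n (β * x)).comp x (by simpa using (hasDerivAt_id x).const_mul β)
    refine (h1.mul (hasDerivAt_exp_neg_mul_sq b x)).congr_deriv ?_
    ring
  have h := integral_eq_zero_of_hasDerivAt_of_integrable hd
    (((i0 n).const_mul _).sub (i1.const_mul _)) (i0 (n + 1))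
  rw [integral_sub ((i0 n).const_mul _) (i1.const_mul _), integral_const_mul,
    integral_const_mul] at h
  have e : ∀ x : ℝ, H (n + 2) (β * x) * Real.exp (-b * x ^ 2) =
      β * (x * H (n + 1) (β * x) * Real.exp (-b * x ^ 2)) -
        (n + 1) * (H n (β * x) * Real.exp (-b * x ^ 2)) := fun x => by
    rw [H_add_two]
    ring
  simp_rw [e]
  rw [integral_sub (i1.const_mul _) ((i0 n).const_mul _), integral_const_mul, integral_const_mul]
  generalize (∫ x : ℝ, H n (β * x) * Real.exp (-b * x ^ 2)) = J at h ⊢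
  generalize (∫ x : ℝ, x * H (n + 1) (β * x) * Real.exp (-b * x ^ 2)) = K at h ⊢
  field_simp
  linear_combination (-β) * h

theorem abs_integral_H_mul_exp_le {b β : ℝ} (hb : 0 < b) (hβ : |β ^ 2 / (2 * b) - 1| ≤ 1)
    (n : ℕ) : |∫ x : ℝ, H n (β * x) * Real.exp (-b * x ^ 2)| ≤
      √(n.factorial : ℝ) * √(Real.pi / b) := by
  induction n using Nat.twoStepInduction with
  | zero =>
    simp only [H_zero, one_mul, integral_gaussian, Nat.factorial_zero, Nat.cast_one, Real.sqrt_one]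
    exact (abs_of_nonneg (Real.sqrt_nonneg _)).le
  | one =>
    rw [integral_H_one_mul_exp hb, abs_zero]
    positivity
  | more n h0 _ =>
    rw [integral_H_add_two_mul_exp hb, abs_mul, abs_mul,
      abs_of_pos (by positivity : (0 : ℝ) < n + 1)]
    have hf : (n + 1) * √(n.factorial : ℝ) ≤ √((n + 2).factorial : ℝ) := by
      refine Real.le_sqrt_of_sq_le ?_
      rw [mul_pow, Real.sq_sqrt (by positivity), Nat.factorial_succ, Nat.factorial_succ]
      push_cast
      nlinarith [(by positivity : 0 ≤ ((n : ℝ) + 1) * n.factorial)]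
    calc _ ≤ ((n : ℝ) + 1) * 1 * (√(n.factorial : ℝ) * √(Real.pi / b)) := by gcongr
      _ = ((n + 1) * √(n.factorial : ℝ)) * √(Real.pi / b) := by ring
      _ ≤ _ := by gcongr

theorem abs_integral_scaled_hermite_le {β : ℝ} (hβ : 0 < β) (n : ℕ) :
    |∫ t, √(β / (n.factorial : ℝ)) * Real.exp (-((β ^ 2 - 1) / 4) * t ^ 2) * H n (β * t)
      ∂stdGauss| ≤ 1 := by
  have hb : 0 < (β ^ 2 + 1) / 4 := by positivity
  have hc : |β ^ 2 / (2 * ((β ^ 2 + 1) / 4)) - 1| ≤ 1 := by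
    rw [abs_le]
    constructor
    · have : 0 ≤ β ^ 2 / (2 * ((β ^ 2 + 1) / 4)) := by positivity
      linarith
    · rw [sub_le_iff_le_add, div_le_iff₀ (by positivity)]
      nlinarith
  have h := abs_integral_H_mul_exp_le hb hc n
  have e : ∀ t : ℝ, gaussianPDFReal 0 1 t •
      (√(β / (n.factorial : ℝ)) * Real.exp (-((β ^ 2 - 1) / 4) * t ^ 2) * H n (β * t)) =
      ((√(2 * Real.pi))⁻¹ * √(β / (n.factorial : ℝ))) *
        (H n (β * t) * Real.exp (-((β ^ 2 + 1) / 4) * t ^ 2)) := fun t => by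
    rw [show -((β ^ 2 + 1) / 4) * t ^ 2 = -t ^ 2 / 2 + -((β ^ 2 - 1) / 4) * t ^ 2 by ring,
      Real.exp_add]
    simp [gaussianPDFReal]
    ring
  rw [stdGauss, integral_gaussianReal_eq_integral_smul one_ne_zero]
  simp_rw [e]
  rw [integral_const_mul, abs_mul, abs_of_nonneg (by positivity)]
  calc _ ≤ ((√(2 * Real.pi))⁻¹ * √(β / (n.factorial : ℝ))) *
        (√(n.factorial : ℝ) * √(Real.pi / ((β ^ 2 + 1) / 4))) := by gcongr
    _ = √(2 * β / (β ^ 2 + 1)) := by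
      rw [← Real.sqrt_inv, ← Real.sqrt_mul (by positivity), ← Real.sqrt_mul (by positivity),
        ← Real.sqrt_mul (by positivity)]
      congr 1
      field_simp
      norm_num
    _ ≤ 1 := by
      refine Real.sqrt_le_one.2 ((div_le_one (by positivity)).2 ?_)
      nlinarith [sq_nonneg (β - 1)]

theorem abs_scaled_hermite_le {β : ℝ} (hβ : 0 < β) (n : ℕ) (x : ℝ) :
    |√(β / (n.factorial : ℝ)) * Real.exp (-((β ^ 2 - 1) / 4) * x ^ 2) * H n (β * x)| ≤
      1.087 * √β * Real.exp (x ^ 2 / 4) := by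
  have hf : √(n.factorial : ℝ) ≠ 0 := (Real.sqrt_pos.2 (by positivity)).ne'
  rw [abs_mul, abs_of_nonneg (by positivity)]
  calc _ ≤ √(β / (n.factorial : ℝ)) * Real.exp (-((β ^ 2 - 1) / 4) * x ^ 2) *
        (1.087 * √(n.factorial : ℝ) * Real.exp ((β * x) ^ 2 / 4)) := by
        gcongr
        exact abs_H_le n _
    _ = 1.087 * √β *
        (Real.exp (-((β ^ 2 - 1) / 4) * x ^ 2) * Real.exp ((β * x) ^ 2 / 4)) := by
      rw [Real.sqrt_div hβ.le]
      field_simp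
    _ = _ := by
      rw [← Real.exp_add]
      ring_nf

theorem exp_two_mul_lt {u : ℝ} (h0 : 0 < u) (h1 : u < 1) :
    (1 - u) / (1 + u) * Real.exp (2 * u) < 1 := by
  have hs := Real.hasSum_log_sub_log_of_abs_lt_one (x := u) (by rwa [abs_of_pos h0])
  have h := sum_le_hasSum (Finset.range 2) (fun i _ => by positivity) hs
  have h3 : 0 < u ^ 3 := by positivity
  norm_num [Finset.sum_range_succ] at h
  rw [← Real.log_div (by linarith) (by linarith)] at h
  have hlt : Real.exp (2 * u) < (1 + u) / (1 - u) :=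
    (Real.lt_log_iff_exp_lt (div_pos (by linarith) (by linarith))).1 (by linarith)
  rw [lt_div_iff₀ (by linarith)] at hlt
  rw [div_mul_eq_mul_div, div_lt_one (by linarith)]
  linarith

theorem stmt_15 (ℓ α : ℝ) (hℓ : 0 < ℓ) (hα : α = 1 / Real.sqrt 2)
    (ε β δ2 : ℝ)
    (hε : ε = 1 / (Real.sqrt 2 * ℓ))
    (hβ : β = (1 + (2 * ε / α) ^ 2) ^ ((1 : ℝ) / 4))
    (hδ2 : δ2 = α ^ 2 * (β ^ 2 - 1) / 2)
    (φ : ℕ → ℝ → ℝ)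
    (hφ : ∀ n x, φ n x = Real.sqrt (β / (n.factorial : ℝ)) * Real.exp (-δ2 * x ^ 2) *
      H n (Real.sqrt 2 * α * β * x))
    (τ lam : ℝ)
    (hτ : τ = Real.sqrt ((1 / 2) / (1 / 2 + δ2 + ε ^ 2)))
    (hlamdef : lam = ε ^ 2 / (1 / 2 + δ2 + ε ^ 2))
    (lamE : ℕ → ℝ) (hlamE : ∀ n, lamE n = τ * lam ^ n)
    (M N : ℕ) (hM : 1 ≤ M)
    (x w : Fin N → ℝ) (W : ℝ) (hW : 0 ≤ W)
    (hw : ∑ m, |w m| ≤ W)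
    (hexact : ∀ n < M, ∑ m, w m * φ n (x m) = ∫ t, φ n t ∂stdGauss)
    (hx : ∀ m, |x m| ≤ 2 * Real.sqrt M / β) :
    (∑' n : ℕ, Real.sqrt (lamE (M + n)) *
        |(∫ t, φ (M + n) t ∂stdGauss) - ∑ m, w m * φ (M + n) (x m)|) ≤
      (1 + 1.087 * Real.sqrt β * W) * (Real.sqrt τ / (1 - Real.sqrt lam)) *
        (Real.sqrt lam * Real.exp (1 / β ^ 2)) ^ M ∧
    Real.sqrt lam * Real.exp (1 / β ^ 2) < 1 := by
  have h2 : √2 * α = 1 := by rw [hα]; field_simp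
  have hα2 : α ^ 2 = 1 / 2 := by rw [hα, div_pow, Real.sq_sqrt two_pos.le, one_pow]
  have hε0 : 0 < ε := by rw [hε]; positivity
  have hβ0 : 0 < β := by rw [hβ]; positivity
  have hβ4 : β ^ 4 = 1 + 8 * ε ^ 2 := by
    rw [hβ, ← Real.rpow_natCast, ← Real.rpow_mul (by positivity), div_pow, hα2]
    norm_num
    ring
  have hβ1 : 1 < β ^ 2 := by nlinarith [sq_nonneg (β ^ 2 - 1), sq_pos_of_pos hε0]
  have hδ : δ2 = (β ^ 2 - 1) / 4 := by rw [hδ2, hα2]; ring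
  have hφ' : ∀ n t, φ n t = √(β / (n.factorial : ℝ)) *
      Real.exp (-((β ^ 2 - 1) / 4) * t ^ 2) * H n (β * t) := fun n t => by
    rw [hφ, h2, one_mul, hδ]
  have hlam : lam = (1 - 1 / β ^ 2) / (1 + 1 / β ^ 2) := by
    have hε2 : ε ^ 2 = (β ^ 4 - 1) / 8 := by linarith
    rw [hlamdef, hδ, hε2, show 1 / 2 + (β ^ 2 - 1) / 4 + (β ^ 4 - 1) / 8 =
      (β ^ 2 + 1) ^ 2 / 8 by ring]
    field_simp
    ring
  have hu1 : 1 / β ^ 2 < 1 := (div_lt_one (by positivity)).2 hβ1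
  have hu0 : 0 < 1 / β ^ 2 := by positivity
  have hlam0 : 0 ≤ lam := hlam ▸ div_nonneg (by linarith) (by linarith)
  have hq1 : √lam < 1 := by
    rw [Real.sqrt_lt' one_pos, hlam, one_pow, div_lt_one (by linarith)]
    linarith
  have hτ0 : 0 ≤ τ := hτ ▸ Real.sqrt_nonneg _
  set q := √lam with hq
  have hq0 : 0 ≤ q := Real.sqrt_nonneg _
  set E := Real.exp (1 / β ^ 2) with hE
  have hE1 : 1 ≤ E := Real.one_le_exp hu0.le
  refine ⟨?_, ?_⟩
  · set A := 1 + 1.087 * √β * W with hA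
    have hterm : ∀ n, √(lamE (M + n)) *
        |(∫ t, φ (M + n) t ∂stdGauss) - ∑ m, w m * φ (M + n) (x m)| ≤
        √τ * (q * E) ^ M * A * q ^ n := fun n => by
      have hint : |∫ t, φ (M + n) t ∂stdGauss| ≤ 1 := by
        simp_rw [hφ']
        exact abs_integral_scaled_hermite_le hβ0 _
      have hpt : ∀ m, |φ (M + n) (x m)| ≤ 1.087 * √β * E ^ M := fun m => by
        rw [hφ', hE, ← Real.exp_nat_mul]
        refine (abs_scaled_hermite_le hβ0 _ _).trans ?_
        gcongr
        have := pow_le_pow_left₀ (abs_nonneg _) (hx m) 2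
        rw [sq_abs, div_pow, mul_pow, Real.sq_sqrt M.cast_nonneg] at this
        calc x m ^ 2 / 4 ≤ (2 ^ 2 * M / β ^ 2) / 4 := by gcongr
          _ = _ := by ring
      have hsum : |∑ m, w m * φ (M + n) (x m)| ≤ W * (1.087 * √β * E ^ M) := by
        refine (Finset.abs_sum_le_sum_abs _ _).trans ?_
        refine le_trans (Finset.sum_le_sum fun m _ => ?_)
          ((Finset.sum_mul _ _ _).symm.trans_le (mul_le_mul_of_nonneg_right hw (by positivity)))
        rw [abs_mul]
        exact mul_le_mul_of_nonneg_left (hpt m) (abs_nonneg _)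
      have hdiff : |(∫ t, φ (M + n) t ∂stdGauss) - ∑ m, w m * φ (M + n) (x m)| ≤ E ^ M * A := by
        refine (abs_sub _ _).trans ?_
        have := one_le_pow₀ hE1 (n := M)
        rw [hA]
        linarith
      have hsq : √(lamE (M + n)) = √τ * q ^ (M + n) := by
        rw [hlamE, Real.sqrt_mul hτ0, show lam ^ (M + n) = (q ^ (M + n)) ^ 2 by
          rw [pow_right_comm, hq, Real.sq_sqrt hlam0], Real.sqrt_sq (by positivity)]
      rw [hsq]
      calc _ ≤ √τ * q ^ (M + n) * (E ^ M * A) := by gcongr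
        _ = _ := by rw [pow_add, mul_pow]; ring
    have hg : HasSum (fun n => √τ * (q * E) ^ M * A * q ^ n)
        (√τ * (q * E) ^ M * A * (1 - q)⁻¹) :=
      (hasSum_geometric_of_lt_one hq0 hq1).mul_left _
    have hs := Summable.of_nonneg_of_le (fun n => by positivity) hterm hg.summable
    refine (hs.tsum_le_tsum hterm hg.summable).trans_eq ?_
    rw [hg.tsum_eq, div_eq_mul_inv]
    ring
  · refine lt_of_pow_lt_pow_left₀ 2 zero_le_one ?_
    rw [mul_pow, hq, Real.sq_sqrt hlam0, hE, ← Real.exp_nat_mul, one_pow, hlam]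
    exact exp_two_mul_lt hu0 hu1
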